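/- arXiv:1801.08448 — 5 statements merged into one kernel-verified Lean document; each statement's English description precedes it below -/
import Mathlib

section
/- Let G be a connected finite simple graph whose clique number equals 4 (i.e., G contains K_4 as a subgraph but not K_5) and whose maximum degree Δ satisfies Δ ≥ 5. Then the distinguishing number of G satisfies D(G) ≤ Δ − 1. -/
open SimpleGraph

/-- The distinguishing number of a graph `G`: the least `d` such that `G` has a vertex
labeling with `d` labels that is preserved only by the identity automorphism. -/
noncomputable def distinguishingNumber {V : Type*} (G : SimpleGraph V) : ℕ :=
  sInf {d | ∃ c : V → Fin d, ∀ f : G ≃g G, (∀ v, c (f v) = c v) → ∀ v, f v = v}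

namespace SimpleGraph

/-- A nonempty proper vertex set of a connected graph is left by some edge. -/
theorem Connected.exists_adj_mem_notMem {V : Type*} {G : SimpleGraph V} (hG : G.Connected)
    {S : Set V} {x y : V} (hx : x ∈ S) (hy : y ∉ S) : ∃ u ∈ S, ∃ v ∉ S, G.Adj u v := by
  obtain ⟨w⟩ := hG.preconnected x y
  obtain ⟨e, -, h1, h2⟩ := w.exists_boundary_dart S hx hy
  exact ⟨e.fst, h1, e.snd, h2, e.adj⟩

end SimpleGraph

/-- A finite set of at most `n` elements can be labeled injectively by `m, …, m + n - 1`. -/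
theorem exists_injOn_nat_interval {V : Type*} (S : Finset V) (m n : ℕ) (h : S.card ≤ n) :
    ∃ g : V → ℕ, Set.InjOn g S ∧ ∀ v ∈ S, m ≤ g v ∧ g v < m + n := by
  classical
  let e := S.equivFin
  refine ⟨fun v => if hv : v ∈ S then m + (e ⟨v, hv⟩).val else 0, ?_, ?_⟩
  · intro x hx y hy hxy
    have hx' : x ∈ S := hx
    have hy' : y ∈ S := hy
    simp only [hx', hy', dite_true, Nat.add_left_cancel_iff] at hxy
    simpa using e.injective (Fin.ext hxy)
  · intro v hv
    have := (e ⟨v, hv⟩).isLt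
    simp only [hv, dite_true]
    omega

/-- A finite set of at most `n` elements can be labeled injectively by `m, …, m + n - 1` with a
prescribed element receiving the label `m`. -/
theorem exists_injOn_nat_interval_apply_eq {V : Type*} (S : Finset V) (m n : ℕ)
    (h : S.card ≤ n) {y : V} (hy : y ∈ S) :
    ∃ g : V → ℕ, Set.InjOn g S ∧ (∀ v ∈ S, m ≤ g v ∧ g v < m + n) ∧ g y = m := by
  classical
  have hc := Finset.card_erase_add_one hy
  obtain ⟨g, hg, hb⟩ := exists_injOn_nat_interval (S.erase y) (m + 1) (n - 1) (by omega)
  have hb' : ∀ v ∈ S, v ≠ y → m + 1 ≤ g v ∧ g v < m + 1 + (n - 1) := fun v hv hvy =>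
    hb v (Finset.mem_erase.2 ⟨hvy, hv⟩)
  refine ⟨Function.update g y m, ?_, ?_, by simp⟩
  · intro u hu v hv huv
    by_cases h1 : u = y <;> by_cases h2 : v = y
    · rw [h1, h2]
    · have := hb' v hv h2
      simp [h1, h2] at huv
      omega
    · have := hb' u hu h1
      simp [h1, h2] at huv
      omega
    · simp only [Function.update_of_ne h1, Function.update_of_ne h2] at huv
      exact hg (by simpa [h1] using hu) (by simpa [h2] using hv) huv
  · intro v hv
    by_cases h1 : v = y
    · simp [h1]; omega
    · have := hb' v hv h1
      simp only [Function.update_of_ne h1]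
      omega

/-- A labeling `c` by `0, …, k - 1`, regarded only on the vertex set `X`, which contains all
neighbors of `P ⊆ X`. Whatever labels the other vertices get, label-preserving automorphisms that
stabilize the edge `ad` fix `X` pointwise, and the triangles labeled `0, 0, 1` all have `ad` as
their edge with equal labels. -/
structure IsRigidLabeling {V : Type*} [DecidableEq V] (G : SimpleGraph V) (k : ℕ) (a d : V)
    (P X : Finset V) (c : V → ℕ) : Prop where
  subset : P ⊆ X
  nbr_mem : ∀ p ∈ P, ∀ v, G.Adj p v → v ∈ X
  exists_parent : ∀ v ∈ X, ∃ p ∈ P, G.Adj p v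
  lt : ∀ v ∈ X, c v < k
  left_mem : a ∈ P
  right_mem : d ∈ P
  adj : G.Adj a d
  left_eq : c a = 0
  right_eq : c d = 0
  exists_apex : ∃ b, G.Adj a b ∧ G.Adj d b ∧ c b = 1
  rigid : ∀ c' : V → ℕ, (∀ v ∈ X, c' v = c v) → ∀ f : G ≃g G, (∀ v, c' (f v) = c' v) →
    (f a = a ∨ f a = d) → (f d = a ∨ f d = d) → ∀ v ∈ X, f v = v
  triangle : ∀ x ∈ X, ∀ y ∈ X, G.Adj x y → c x = 0 → c y = 0 → ∀ z, G.Adj x z → G.Adj y z →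
    z ∈ X ∧ (c z = 1 → (x = a ∨ x = d) ∧ (y = a ∨ y = d))

namespace IsRigidLabeling

variable {V : Type*} [Fintype V] [DecidableEq V] {G : SimpleGraph V}
  {k : ℕ} {a d : V} {P X : Finset V} {c : V → ℕ}

/-- A rigid labeling of all vertices is preserved only by the identity automorphism. -/
theorem eq_of_forall_apply_eq (h : IsRigidLabeling G k a d Finset.univ Finset.univ c) (f : G ≃g G)
    (hf : ∀ v, c (f v) = c v) (v : V) : f v = v := by
  obtain ⟨b, hab, hdb, hb⟩ := h.exists_apex
  have h1 := (h.triangle (f a) (Finset.mem_univ _) (f d) (Finset.mem_univ _)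
    (f.map_adj_iff.2 h.adj) (by rw [hf, h.left_eq]) (by rw [hf, h.right_eq]) (f b)
    (f.map_adj_iff.2 hab) (f.map_adj_iff.2 hdb)).2 (by rw [hf, hb])
  exact h.rigid c (fun _ _ => rfl) f hf h1.1 h1.2 v (Finset.mem_univ v)

variable [DecidableRel G.Adj]

/-- Labeling the unlabeled neighbors of a vertex `p ∈ X` by `g` gives a rigid labeling again if
equally labeled ones are told apart by their neighbors in `X` and no new triangles labeled
`0, 0, 1` can arise. -/
theorem extend (h : IsRigidLabeling G k a d P X c) {p : V} (hp : p ∈ X) {g : V → ℕ}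
    (hlt : ∀ v ∈ G.neighborFinset p \ X, g v < k)
    (hg : ∀ s ∈ G.neighborFinset p \ X, ∀ t ∈ G.neighborFinset p \ X, g s = g t → s ≠ t →
      ∃ w ∈ X, ¬ (G.Adj w s ↔ G.Adj w t))
    (hz : ∀ s ∈ G.neighborFinset p \ X, ∀ t ∈ G.neighborFinset p \ X, g s = 0 → g t = 0 → s = t)
    (ht : ∀ x ∈ X, ∀ y ∈ G.neighborFinset p \ X, G.Adj x y → c x = 0 → g y = 0 →
      ∀ z, G.Adj x z → G.Adj y z → z ∈ G.neighborFinset p \ X ∧ g z ≠ 1) :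
    ∃ c', IsRigidLabeling G k a d (insert p P) (X ∪ G.neighborFinset p) c' := by
  let c' : V → ℕ := fun v => if v ∈ X then c v else g v
  have hX : ∀ v ∈ X, c' v = c v := fun v hv => by simp [c', hv]
  have hS : ∀ v, v ∉ X → c' v = g v := fun v hv => by simp [c', hv]
  have hU : ∀ v ∈ X ∪ G.neighborFinset p, v ∉ X → v ∈ G.neighborFinset p \ X := fun v hv hvX => by
    simp only [Finset.mem_union] at hv
    simp only [Finset.mem_sdiff]
    tauto
  have haX := h.subset h.left_mem
  have hdX := h.subset h.right_mem
  refine ⟨c', ?_, ?_, ?_, ?_, ?_, ?_, h.adj, ?_, ?_, ?_, ?_, ?_⟩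
  · intro v hv
    rcases Finset.mem_insert.1 hv with rfl | hv
    · exact Finset.mem_union_left _ hp
    · exact Finset.mem_union_left _ (h.subset hv)
  · intro q hq v hv
    rcases Finset.mem_insert.1 hq with rfl | hq
    · exact Finset.mem_union_right _ (by simpa using hv)
    · exact Finset.mem_union_left _ (h.nbr_mem q hq v hv)
  · intro v hv
    rcases Finset.mem_union.1 hv with hv | hv
    · obtain ⟨q, hq, hqv⟩ := h.exists_parent v hv
      exact ⟨q, Finset.mem_insert_of_mem hq, hqv⟩
    · exact ⟨p, Finset.mem_insert_self _ _, by simpa using hv⟩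
  · intro v hv
    by_cases hvX : v ∈ X
    · rw [hX v hvX]; exact h.lt v hvX
    · rw [hS v hvX]; exact hlt v (hU v hv hvX)
  · exact Finset.mem_insert_of_mem h.left_mem
  · exact Finset.mem_insert_of_mem h.right_mem
  · rw [hX a haX, h.left_eq]
  · rw [hX d hdX, h.right_eq]
  · obtain ⟨b, hab, hdb, hb⟩ := h.exists_apex
    exact ⟨b, hab, hdb, by rw [hX b (h.nbr_mem a h.left_mem b hab), hb]⟩
  · intro e he f hf hfa hfd
    have hfX : ∀ v ∈ X, f v = v := h.rigid e
      (fun v hv => (he v (Finset.mem_union_left _ hv)).trans (hX v hv)) f hf hfa hfd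
    intro v hv
    by_cases hvX : v ∈ X
    · exact hfX v hvX
    have hvS := hU v hv hvX
    have hfvX : f v ∉ X := fun hc => hvX (by rwa [f.injective (hfX _ hc)] at hc)
    have hfvp : G.Adj p (f v) := by
      have h1 : G.Adj p v := by simpa using (Finset.mem_sdiff.1 hvS).1
      simpa [hfX p hp] using f.map_adj_iff.2 h1
    have hfvS : f v ∈ G.neighborFinset p \ X := by simp [hfvp, hfvX]
    have hcol : g (f v) = g v := by
      rw [← hS _ hvX, ← hS _ hfvX, ← he _ hv,
        ← he _ (Finset.mem_union_right _ (by simpa using hfvp))]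
      exact hf v
    by_contra hne
    obtain ⟨w, hw, hwv⟩ := hg _ hfvS _ hvS hcol hne
    apply hwv
    have := f.map_adj_iff (v := w) (w := v)
    rwa [hfX w hw] at this
  · have key : ∀ x ∈ X, ∀ y ∈ G.neighborFinset p \ X, G.Adj x y → c' x = 0 → c' y = 0 →
        ∀ z, G.Adj x z → G.Adj y z → z ∈ X ∪ G.neighborFinset p ∧ c' z ≠ 1 := by
      intro x hx y hy hxy hcx hcy z hxz hyz
      rw [hX x hx] at hcx
      rw [hS y (Finset.mem_sdiff.1 hy).2] at hcy
      obtain ⟨h1, h2⟩ := ht x hx y hy hxy hcx hcy z hxz hyz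
      have h3 := Finset.mem_sdiff.1 h1
      exact ⟨Finset.mem_union_right _ h3.1, by rwa [hS z h3.2]⟩
    intro x hx y hy hxy hcx hcy z hxz hyz
    by_cases hxX : x ∈ X <;> by_cases hyX : y ∈ X
    · rw [hX x hxX] at hcx
      rw [hX y hyX] at hcy
      obtain ⟨h1, h2⟩ := h.triangle x hxX y hyX hxy hcx hcy z hxz hyz
      exact ⟨Finset.mem_union_left _ h1, by rwa [hX z h1]⟩
    · obtain ⟨h1, h2⟩ := key x hxX y (hU y hy hyX) hxy hcx hcy z hxz hyz
      exact ⟨h1, fun h3 => absurd h3 h2⟩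
    · obtain ⟨h1, h2⟩ := key y hyX x (hU x hx hxX) hxy.symm hcy hcx z hyz hxz
      exact ⟨h1, fun h3 => absurd h3 h2⟩
    · rw [hS x hxX] at hcx
      rw [hS y hyX] at hcy
      exact absurd (hz x (hU x hx hxX) y (hU y hy hyX) hcx hcy) hxy.ne

/-- In a `K₅`-free graph of maximum degree at most `k + 1`, where `4 ≤ k`, a rigid labeling can be
extended to the neighbors of any labeled vertex. -/
theorem exists_extend (h : IsRigidLabeling G k a d P X c) (hk : 4 ≤ k) (hK5 : G.CliqueFree 5)
    (hdeg : ∀ v, G.degree v ≤ k + 1) {p : V} (hp : p ∈ X) :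
    ∃ c', IsRigidLabeling G k a d (insert p P) (X ∪ G.neighborFinset p) c' := by
  set S := G.neighborFinset p \ X
  have hSX : ∀ v ∈ S, v ∉ X := fun v hv => (Finset.mem_sdiff.1 hv).2
  have hSp : ∀ v ∈ S, G.Adj p v := fun v hv => by simpa using (Finset.mem_sdiff.1 hv).1
  have hparent : ∀ x ∈ X, S ⊆ G.neighborFinset x → ∀ w ∈ X, G.Adj x w →
      S.card ≤ k ∧ (S.card = k → G.neighborFinset x = insert w S) := by
    intro x hx hSx w hw hxw
    have hwS : w ∉ S := fun hc => hSX w hc hw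
    have hsub : insert w S ⊆ G.neighborFinset x := by
      intro v hv
      rcases Finset.mem_insert.1 hv with rfl | hv
      · simpa using hxw
      · exact hSx hv
    have h1 := Finset.card_le_card hsub
    have h2 := hdeg x
    rw [Finset.card_insert_of_notMem hwS, card_neighborFinset_eq_degree] at h1
    refine ⟨by omega, fun h3 => (Finset.eq_of_subset_of_card_le hsub ?_).symm⟩
    rw [Finset.card_insert_of_notMem hwS, card_neighborFinset_eq_degree]
    omega
  have hScard : S.card ≤ k := by
    obtain ⟨w, hw, hwp⟩ := h.exists_parent p hp
    exact (hparent p hp Finset.sdiff_subset w (h.subset hw) hwp.symm).1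
  rcases hScard.lt_or_eq with hlt | heq
  · obtain ⟨g, hg, hb⟩ := exists_injOn_nat_interval S 1 (k - 1) (by omega)
    refine h.extend hp (g := g) (fun v hv => ?_) (fun s hs t ht hst hne => ?_)
      (fun s hs t ht h1 h2 => ?_) (fun x _ y hy _ _ h1 => ?_)
    · have := hb v hv; omega
    · exact absurd (hg hs ht hst) hne
    · have := hb s hs; omega
    · have := hb y hy; omega
  by_cases htw : ∀ u ∈ S, ∀ v ∈ S, ∀ w ∈ X, G.Adj w u → G.Adj w v
  · obtain ⟨y, hy, z, hz, hyz, hnadj⟩ : ∃ y ∈ S, ∃ z ∈ S, y ≠ z ∧ ¬ G.Adj y z := by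
      by_contra! hcl
      obtain ⟨T, hTS, hT⟩ := Finset.exists_subset_card_eq (s := S) (n := 4) (by omega)
      have hclT : G.IsNClique 4 T :=
        ⟨fun u hu v hv huv => hcl u (hTS hu) v (hTS hv) huv, hT⟩
      exact hK5 _ (hclT.insert fun b hb => hSp b (hTS hb))
    obtain ⟨g, hg, hb, hgz⟩ := exists_injOn_nat_interval_apply_eq (S.erase y) 1 (k - 1)
      (by rw [Finset.card_erase_of_mem hy]; omega) (Finset.mem_erase.2 ⟨hyz.symm, hz⟩)
    have hb' : ∀ v ∈ S, v ≠ y → 1 ≤ g v ∧ g v < 1 + (k - 1) := fun v hv hvy =>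
      hb v (Finset.mem_erase.2 ⟨hvy, hv⟩)
    have hzero : ∀ v ∈ S, Function.update g y 0 v = 0 → v = y := by
      intro v hv hv0
      by_contra hvy
      have := hb' v hv hvy
      rw [Function.update_of_ne hvy] at hv0
      omega
    refine h.extend hp (g := Function.update g y 0) (fun v hv => ?_)
      (fun s hs t ht hst hne => ?_) (fun s hs t ht h1 h2 => ?_)
      (fun x hx v hv hxv hcx hcv t hxt hvt => ?_)
    · by_cases hvy : v = y
      · simp [hvy]; omega
      · have := hb' v hv hvy
        rw [Function.update_of_ne hvy]
        omega
    · exfalso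
      by_cases h1 : s = y
      · rw [h1, Function.update_self] at hst
        exact hne (h1.trans (hzero t ht hst.symm).symm)
      by_cases h2 : t = y
      · rw [h2, Function.update_self] at hst
        exact h1 (hzero s hs hst)
      rw [Function.update_of_ne h1, Function.update_of_ne h2] at hst
      exact hne (hg (Finset.mem_erase.2 ⟨h1, hs⟩) (Finset.mem_erase.2 ⟨h2, ht⟩) hst)
    · rw [hzero s hs h1, hzero t ht h2]
    · obtain rfl := hzero v hv hcv
      obtain ⟨w, hw, hwx⟩ := h.exists_parent x hx
      have hN := (hparent x hx (fun u hu => by simpa using htw v hv u hu x hx hxv) w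
        (h.subset hw) hwx.symm).2 heq
      have htN : t ∈ insert w S := by rw [← hN]; simpa using hxt
      rcases Finset.mem_insert.1 htN with rfl | htS
      · exact absurd (h.nbr_mem t hw v hvt.symm) (hSX v hv)
      · refine ⟨htS, fun ht1 => hnadj ?_⟩
        rw [Function.update_of_ne hvt.ne'] at ht1
        have : t = z := hg (Finset.mem_erase.2 ⟨hvt.ne', htS⟩)
          (Finset.mem_erase.2 ⟨hyz.symm, hz⟩) (ht1.trans hgz.symm)
        rwa [← this]
  · push Not at htw
    obtain ⟨u, hu, v, hv, w, hw, hwu, hwv⟩ := htw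
    have huv : u ≠ v := by rintro rfl; exact hwv hwu
    have hue : u ∈ S.erase v := Finset.mem_erase.2 ⟨huv, hu⟩
    obtain ⟨g, hg, hb⟩ := exists_injOn_nat_interval (S.erase v) 1 (k - 1)
      (by rw [Finset.card_erase_of_mem hv]; omega)
    have hb' : ∀ s ∈ S, 1 ≤ Function.update g v (g u) s ∧
        Function.update g v (g u) s < 1 + (k - 1) := by
      intro s hs
      by_cases hsv : s = v
      · rw [hsv, Function.update_self]; exact hb u hue
      · rw [Function.update_of_ne hsv]; exact hb s (Finset.mem_erase.2 ⟨hsv, hs⟩)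
    refine h.extend hp (g := Function.update g v (g u)) (fun v hv => ?_)
      (fun s hs t ht hst hne => ?_) (fun s hs t ht h1 h2 => ?_) (fun x _ y hy _ _ h1 => ?_)
    · have := hb' v hv; omega
    · refine ⟨w, hw, ?_⟩
      by_cases h1 : s = v
      · have h2 : t ≠ v := fun h2 => hne (h1.trans h2.symm)
        rw [h1, Function.update_self, Function.update_of_ne h2] at hst
        have : u = t := hg hue (Finset.mem_erase.2 ⟨h2, ht⟩) hst
        rw [h1, ← this]
        tauto
      · rw [Function.update_of_ne h1] at hst
        by_cases h2 : t = v
        · rw [h2, Function.update_self] at hst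
          have : s = u := hg (Finset.mem_erase.2 ⟨h1, hs⟩) hue hst
          rw [this, h2]
          tauto
        · rw [Function.update_of_ne h2] at hst
          exact absurd (hg (Finset.mem_erase.2 ⟨h1, hs⟩) (Finset.mem_erase.2 ⟨h2, ht⟩) hst) hne
    · have := hb' s hs; omega
    · have := hb' y hy; omega

/-- Under the assumptions of `exists_extend`, a rigid labeling of part of a connected graph extends
to all vertices. -/
theorem exists_univ {P X : Finset V} {c : V → ℕ} (hG : G.Connected) (hk : 4 ≤ k) (hK5 : G.CliqueFree 5)
    (hdeg : ∀ v, G.degree v ≤ k + 1) (h : IsRigidLabeling G k a d P X c) :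
    ∃ c', IsRigidLabeling G k a d Finset.univ Finset.univ c' := by
  by_cases hP : P = Finset.univ
  · obtain rfl := hP
    have hX : X = Finset.univ := Finset.univ_subset_iff.1 h.subset
    exact ⟨c, hX ▸ h⟩
  · obtain ⟨y, hy⟩ : ∃ y, y ∉ P := by
      by_contra! hc
      exact hP (Finset.eq_univ_iff_forall.2 hc)
    obtain ⟨u, hu, p, hpP, hup⟩ := hG.exists_adj_mem_notMem (S := (P : Set V)) h.left_mem hy
    obtain ⟨c', h'⟩ := h.exists_extend hk hK5 hdeg (h.nbr_mem u hu p hup)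
    have hdec : (insert p P)ᶜ.card < Pᶜ.card := by
      apply Finset.card_lt_card
      rw [Finset.compl_ssubset_compl]
      exact Finset.ssubset_insert hpP
    exact exists_univ hG hk hK5 hdeg h'
termination_by Pᶜ.card
decreasing_by exact hdec

/-- The neighborhoods of two adjacent vertices `a`, `d` with two further common neighbors have a
rigid labeling, provided that `a` has a neighbor `u` that is not adjacent to `d`. -/
theorem exists_of_adj (hk : 4 ≤ k) (hdeg : ∀ v, G.degree v ≤ k + 1) (had : G.Adj a d)
    {b b' u : V} (hbb : b ≠ b') (hab : G.Adj a b) (hdb : G.Adj d b) (hab' : G.Adj a b')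
    (hdb' : G.Adj d b') (hau : G.Adj a u) (hdu : ¬ G.Adj d u) (hud : u ≠ d) :
    ∃ c, IsRigidLabeling G k a d {a, d} (G.neighborFinset a ∪ G.neighborFinset d) c := by
  let A := (G.neighborFinset a \ G.neighborFinset d).erase d
  let D := (G.neighborFinset d \ G.neighborFinset a).erase a
  let C := G.neighborFinset a ∩ G.neighborFinset d
  have hmA : ∀ v, v ∈ A ↔ v ≠ d ∧ G.Adj a v ∧ ¬ G.Adj d v := fun v => by simp [A]
  have hmD : ∀ v, v ∈ D ↔ v ≠ a ∧ G.Adj d v ∧ ¬ G.Adj a v := fun v => by simp [D]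
  have hmC : ∀ v, v ∈ C ↔ G.Adj a v ∧ G.Adj d v := fun v => by simp [C]
  have hA : A.card ≤ k - 2 := by
    have hsub : A ∪ {d, b, b'} ⊆ G.neighborFinset a := by
      intro v hv
      simp only [Finset.mem_union, hmA, Finset.mem_insert, Finset.mem_singleton] at hv
      rw [mem_neighborFinset]
      rcases hv with hv | rfl | rfl | rfl
      exacts [hv.2.1, had, hab, hab']
    have h1 := Finset.card_le_card hsub
    rw [Finset.card_union_of_disjoint, card_neighborFinset_eq_degree,
      Finset.card_eq_three.2 ⟨d, b, b', hdb.ne, hdb'.ne, hbb, rfl⟩] at h1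
    · have := hdeg a
      omega
    · rw [Finset.disjoint_left]
      intro v hv hv'
      rw [hmA] at hv
      simp only [Finset.mem_insert, Finset.mem_singleton] at hv'
      rcases hv' with rfl | rfl | rfl <;> tauto
  have hD : D.card ≤ k - 2 := by
    have hsub : D ∪ {a, b, b'} ⊆ G.neighborFinset d := by
      intro v hv
      simp only [Finset.mem_union, hmD, Finset.mem_insert, Finset.mem_singleton] at hv
      rw [mem_neighborFinset]
      rcases hv with hv | rfl | rfl | rfl
      exacts [hv.2.1, had.symm, hdb, hdb']
    have h1 := Finset.card_le_card hsub
    rw [Finset.card_union_of_disjoint, card_neighborFinset_eq_degree,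
      Finset.card_eq_three.2 ⟨a, b, b', hab.ne, hab'.ne, hbb, rfl⟩] at h1
    · have := hdeg d
      omega
    · rw [Finset.disjoint_left]
      intro v hv hv'
      rw [hmD] at hv
      simp only [Finset.mem_insert, Finset.mem_singleton] at hv'
      rcases hv' with rfl | rfl | rfl <;> tauto
  have hC : C.card ≤ k - 1 := by
    have hsub : C ∪ {d, u} ⊆ G.neighborFinset a := by
      intro v hv
      simp only [Finset.mem_union, hmC, Finset.mem_insert, Finset.mem_singleton] at hv
      rw [mem_neighborFinset]
      rcases hv with hv | rfl | rfl
      exacts [hv.1, had, hau]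
    have h1 := Finset.card_le_card hsub
    rw [Finset.card_union_of_disjoint, card_neighborFinset_eq_degree,
      Finset.card_pair hud.symm] at h1
    · have := hdeg a
      omega
    · rw [Finset.disjoint_left]
      intro v hv hv'
      rw [hmC] at hv
      simp only [Finset.mem_insert, Finset.mem_singleton] at hv'
      rcases hv' with rfl | rfl
      · exact G.irrefl hv.2
      · exact hdu hv.2
  have huA : u ∈ A := (hmA u).2 ⟨hud, hau, hdu⟩
  obtain ⟨g₁, hg₁, hb₁, hu₁⟩ := exists_injOn_nat_interval_apply_eq A 1 (k - 1) (by omega) huA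
  obtain ⟨g₂, hg₂, hb₂⟩ := exists_injOn_nat_interval D 2 (k - 2) hD
  obtain ⟨g₃, hg₃, hb₃, hu₃⟩ :=
    exists_injOn_nat_interval_apply_eq C 1 (k - 1) hC ((hmC b).2 ⟨hab, hdb⟩)
  let c : V → ℕ := fun v =>
    if v = a ∨ v = d then 0 else if v ∈ A then g₁ v else if v ∈ D then g₂ v else g₃ v
  have hcA : ∀ v ∈ A, c v = g₁ v := by
    intro v hv
    have h1 := (hmA v).1 hv
    have h2 : ¬ (v = a ∨ v = d) := by
      rintro (rfl | rfl)
      exacts [G.irrefl h1.2.1, h1.1 rfl]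
    simp [c, h2, hv]
  have hcD : ∀ v ∈ D, c v = g₂ v := by
    intro v hv
    have h1 := (hmD v).1 hv
    have h2 : ¬ (v = a ∨ v = d) := by
      rintro (rfl | rfl)
      exacts [h1.1 rfl, G.irrefl h1.2.1]
    have h3 : v ∉ A := by rw [hmA]; tauto
    simp [c, h2, h3, hv]
  have hcC : ∀ v ∈ C, c v = g₃ v := by
    intro v hv
    have h1 := (hmC v).1 hv
    have h2 : ¬ (v = a ∨ v = d) := by
      rintro (rfl | rfl)
      exacts [G.irrefl h1.1, G.irrefl h1.2]
    have h3 : v ∉ A := by rw [hmA]; tauto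
    have h4 : v ∉ D := by rw [hmD]; tauto
    simp [c, h2, h3, h4]
  have hca : c a = 0 := by simp [c]
  have hcd : c d = 0 := by simp [c]
  have hcases : ∀ v ∈ G.neighborFinset a ∪ G.neighborFinset d,
      v = a ∨ v = d ∨ v ∈ A ∨ v ∈ D ∨ v ∈ C := by
    intro v hv
    simp only [Finset.mem_union, mem_neighborFinset] at hv
    rw [hmA, hmD, hmC]
    tauto
  have hbound : ∀ v ∈ G.neighborFinset a ∪ G.neighborFinset d,
      c v < k ∧ (c v = 0 → v = a ∨ v = d) := by
    intro v hv
    rcases hcases v hv with rfl | rfl | h1 | h1 | h1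
    · exact ⟨by omega, fun _ => Or.inl rfl⟩
    · exact ⟨by omega, fun _ => Or.inr rfl⟩
    · have := hb₁ v h1
      rw [hcA v h1]
      exact ⟨by omega, fun h2 => by omega⟩
    · have := hb₂ v h1
      rw [hcD v h1]
      exact ⟨by omega, fun h2 => by omega⟩
    · have := hb₃ v h1
      rw [hcC v h1]
      exact ⟨by omega, fun h2 => by omega⟩
  have hAX : ∀ v ∈ A, v ∈ G.neighborFinset a ∪ G.neighborFinset d := fun v hv => by
    simp [((hmA v).1 hv).2.1]
  have hDX : ∀ v ∈ D, v ∈ G.neighborFinset a ∪ G.neighborFinset d := fun v hv => by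
    simp [((hmD v).1 hv).2.1]
  have hCX : ∀ v ∈ C, v ∈ G.neighborFinset a ∪ G.neighborFinset d := fun v hv => by
    simp [((hmC v).1 hv).1]
  refine ⟨c, ?_, ?_, ?_, fun v hv => (hbound v hv).1, by simp, by simp, had, hca, hcd,
    ⟨b, hab, hdb, by rw [hcC b ((hmC b).2 ⟨hab, hdb⟩), hu₃]⟩, ?_, ?_⟩
  · intro v hv
    simp only [Finset.mem_insert, Finset.mem_singleton] at hv
    rcases hv with rfl | rfl
    · simp [had.symm]
    · simp [had]
  · intro p hp v hpv
    simp only [Finset.mem_insert, Finset.mem_singleton] at hp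
    rcases hp with rfl | rfl <;> simp [hpv]
  · intro v hv
    simpa using hv
  · intro e he f hf hfa hfd
    have hadj : ∀ x y, G.Adj (f x) (f y) ↔ G.Adj x y := fun x y => f.map_adj_iff
    have hfa' : f a = a := by
      by_contra hne
      have h1 : f a = d := hfa.resolve_left hne
      have h2 : f d = a := by
        refine hfd.resolve_right fun h2 => had.ne (f.injective (h1.trans h2.symm))
      have h3 : f u ∈ D := by
        have h3 := hadj a u
        have h4 := hadj d u
        rw [h1] at h3
        rw [h2] at h4
        refine (hmD _).2 ⟨fun h5 => hud (f.injective (h5.trans h2.symm)), h3.2 hau, ?_⟩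
        rwa [h4]
      have h4 := hb₂ _ h3
      have h5 := hf u
      rw [he _ (hDX _ h3), he _ (hAX _ huA), hcD _ h3, hcA _ huA, hu₁] at h5
      omega
    have hfd' : f d = d := hfd.resolve_left fun h1 => had.ne (f.injective (hfa'.trans h1.symm))
    have hadja : ∀ v, G.Adj a (f v) ↔ G.Adj a v := fun v => by
      have := hadj a v
      rwa [hfa'] at this
    have hadjd : ∀ v, G.Adj d (f v) ↔ G.Adj d v := fun v => by
      have := hadj d v
      rwa [hfd'] at this
    intro v hv
    have hcol : f v ∈ G.neighborFinset a ∪ G.neighborFinset d → c (f v) = c v := fun h1 => by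
      rw [← he _ h1, ← he _ hv, hf v]
    rcases hcases v hv with rfl | rfl | h1 | h1 | h1
    · exact hfa'
    · exact hfd'
    · have h2 : f v ∈ A := by
        rw [hmA, hadja, hadjd]
        refine ⟨fun h3 => ?_, ((hmA v).1 h1).2⟩
        exact ((hmA v).1 h1).1 (f.injective (h3.trans hfd'.symm))
      have h3 := hcol (hAX _ h2)
      rw [hcA _ h2, hcA _ h1] at h3
      exact hg₁ h2 h1 h3
    · have h2 : f v ∈ D := by
        rw [hmD, hadja, hadjd]
        refine ⟨fun h3 => ?_, ((hmD v).1 h1).2⟩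
        exact ((hmD v).1 h1).1 (f.injective (h3.trans hfa'.symm))
      have h3 := hcol (hDX _ h2)
      rw [hcD _ h2, hcD _ h1] at h3
      exact hg₂ h2 h1 h3
    · have h2 : f v ∈ C := by
        rw [hmC, hadja, hadjd]
        exact (hmC v).1 h1
      have h3 := hcol (hCX _ h2)
      rw [hcC _ h2, hcC _ h1] at h3
      exact hg₃ h2 h1 h3
  · intro x hx y hy hxy hcx hcy z hxz hyz
    have h1 := (hbound x hx).2 hcx
    have h2 := (hbound y hy).2 hcy
    refine ⟨?_, fun _ => ⟨h1, h2⟩⟩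
    rcases h1 with rfl | rfl <;> simp [hxz]

end IsRigidLabeling

/-- If `G` is a connected graph with clique number four (it contains `K_4` but is
`K_5`-free) and maximum degree `Δ ≥ 5`, then `D(G) ≤ Δ - 1`. -/
theorem distinguishingNumber_le_of_cliqueNum_four {V : Type*} [Fintype V] [DecidableEq V]
    (G : SimpleGraph V) [DecidableRel G.Adj]
    (hconn : G.Connected)
    (hK4 : ∃ s : Finset V, G.IsNClique 4 s)
    (hK5 : G.CliqueFree 5)
    (hΔ : 5 ≤ G.maxDegree) :
    distinguishingNumber G ≤ G.maxDegree - 1 := by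
  obtain ⟨s, hs⟩ := hK4
  have hdeg : ∀ v, G.degree v ≤ (G.maxDegree - 1) + 1 := fun v => by
    have := G.degree_le_maxDegree v
    omega
  obtain ⟨x, hx⟩ : s.Nonempty := Finset.card_pos.1 (by rw [hs.card_eq]; norm_num)
  obtain ⟨y, hy⟩ : ∃ y, y ∉ s := by
    by_contra! hc
    have h1 : Fintype.card V = 4 := by
      rw [← hs.card_eq, Finset.eq_univ_iff_forall.2 hc, Finset.card_univ]
    have := hconn.nonempty
    have h2 := G.maxDegree_lt_card_verts
    omega
  obtain ⟨a, ha, u, hu, hau⟩ := hconn.exists_adj_mem_notMem (S := (s : Set V)) hx hy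
  obtain ⟨d, hd, hdu⟩ : ∃ d ∈ s, ¬ G.Adj u d := by
    by_contra! hc
    exact hK5 _ (hs.insert hc)
  have had : a ≠ d := by
    rintro rfl
    exact hdu hau.symm
  have hcard : 1 < ((s.erase a).erase d).card := by
    rw [Finset.card_erase_of_mem (Finset.mem_erase.2 ⟨had.symm, hd⟩), Finset.card_erase_of_mem ha,
      hs.card_eq]
    norm_num
  obtain ⟨b, hb, b', hb', hbb⟩ := Finset.one_lt_card.1 hcard
  simp only [Finset.mem_erase] at hb hb'
  have hcl := hs.isClique
  obtain ⟨c₀, h₀⟩ := IsRigidLabeling.exists_of_adj (k := G.maxDegree - 1) (by omega) hdeg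
    (hcl ha hd had) hbb (hcl ha hb.2.2 hb.2.1.symm) (hcl hd hb.2.2 hb.1.symm)
    (hcl ha hb'.2.2 hb'.2.1.symm) (hcl hd hb'.2.2 hb'.1.symm) hau (fun h => hdu h.symm)
    (fun h => hu (h ▸ hd))
  obtain ⟨c, h⟩ := h₀.exists_univ hconn (by omega) hK5 hdeg
  refine Nat.sInf_le ⟨fun v => ⟨c v, h.lt v (Finset.mem_univ v)⟩, fun f hf => ?_⟩
  exact h.eq_of_forall_apply_eq f fun v => by simpa using hf v
end

section
/- If G is a connected finite simple graph of order n ≥ 6 that has exactly one Hamiltonian cycle (i.e., there is a unique cycle in G passing through all n vertices), then the distinguishing number of G satisfies D(G) ≤ 2. -/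
open SimpleGraph

namespace SimpleGraph.Walk

variable {V : Type*} {G : SimpleGraph V} {u : V} {c : G.Walk u u}

/-- The neighbours along a cycle of the vertex at position `i`, for an interior position. -/
theorem IsCycle.eq_or_eq_of_mem_edges (hc : c.IsCycle) {i : ℕ} (h0 : i ≠ 0)
    (hi : i < c.length) {x : V} (h : s(c.getVert i, x) ∈ c.edges) :
    x = c.getVert (i - 1) ∨ x = c.getVert (i + 1) := by
  have h' : x ∈ c.toSubgraph.neighborSet (c.getVert i) := adj_toSubgraph_iff_mem_edges.2 h
  rw [hc.neighborSet_toSubgraph_internal h0 hi] at h'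
  simpa using h'

/-- The neighbours along a cycle of its base vertex. -/
theorem IsCycle.eq_or_eq_of_mem_edges_zero (hc : c.IsCycle) {x : V}
    (h : s(c.getVert 0, x) ∈ c.edges) :
    x = c.getVert 1 ∨ x = c.getVert (c.length - 1) := by
  have h' : x ∈ c.toSubgraph.neighborSet u := adj_toSubgraph_iff_mem_edges.2 (by simpa using h)
  rw [hc.neighborSet_toSubgraph_endpoint] at h'
  simpa [snd, penultimate] using h'

theorem mk_getVert_getVert_succ_mem_edges {G : SimpleGraph V} {u v : V} (p : G.Walk u v) {i : ℕ}
    (hi : i < p.length) : s(p.getVert i, p.getVert (i + 1)) ∈ p.edges :=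
  adj_toSubgraph_iff_mem_edges.1 (p.toSubgraph_adj_getVert hi)

/-- An injective map preserving the edges of a cycle of length at least `6` and the set of
its vertices at positions `0`, `1`, `3` fixes every vertex of the cycle. -/
theorem IsCycle.map_getVert_eq_of_preserves (hc : c.IsCycle) (hlen : 6 ≤ c.length) {f : V → V}
    (hf : Function.Injective f) (hE : ∀ a b, s(a, b) ∈ c.edges → s(f a, f b) ∈ c.edges)
    (hS : ∀ v ∈ ({c.getVert 0, c.getVert 1, c.getVert 3} : Set V),
      f v ∈ ({c.getVert 0, c.getVert 1, c.getVert 3} : Set V)) :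
    ∀ i < c.length, f (c.getVert i) = c.getVert i := by
  have inj : ∀ {i j : ℕ}, i < c.length → j < c.length → c.getVert i = c.getVert j → i = j :=
    fun hi hj h => hc.getVert_injOn' (by simp; omega) (by simp; omega) h
  have n03 : s(c.getVert 0, c.getVert 3) ∉ c.edges := fun h => by
    rcases hc.eq_or_eq_of_mem_edges_zero h with h | h <;>
      have := inj (by omega) (by omega) h <;> omega
  have n13 : s(c.getVert 1, c.getVert 3) ∉ c.edges := fun h => by
    rcases hc.eq_or_eq_of_mem_edges one_ne_zero (by omega) h with h | h <;>
      have := inj (by omega) (by omega) h <;> omega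
  have n02 : ∀ x, s(c.getVert 0, x) ∈ c.edges → s(c.getVert 3, x) ∉ c.edges := fun x h h' => by
    rcases hc.eq_or_eq_of_mem_edges_zero h with rfl | rfl <;>
      rcases hc.eq_or_eq_of_mem_edges three_ne_zero (by omega) h' with h | h <;>
      have := inj (by omega) (by omega) h <;> omega
  have n31 : s(c.getVert 3, c.getVert 1) ∉ c.edges := by rwa [Sym2.eq_swap]
  have n30 : s(c.getVert 3, c.getVert 0) ∉ c.edges := by rwa [Sym2.eq_swap]
  have d01 : f (c.getVert 0) ≠ f (c.getVert 1) := fun h => by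
    have := inj (by omega) (by omega) (hf h); omega
  have d03 : f (c.getVert 0) ≠ f (c.getVert 3) := fun h => by
    have := inj (by omega) (by omega) (hf h); omega
  have d13 : f (c.getVert 1) ≠ f (c.getVert 3) := fun h => by
    have := inj (by omega) (by omega) (hf h); omega
  have e01 := hE _ _ (c.mk_getVert_getVert_succ_mem_edges (i := 0) (by omega))
  have e12 := hE _ _ (c.mk_getVert_getVert_succ_mem_edges (i := 1) (by omega))
  have e32 := hE _ _ (c.mk_getVert_getVert_succ_mem_edges (i := 2) (by omega))
  rw [Sym2.eq_swap] at e32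
  have s0 := hS (c.getVert 0) (by simp)
  have s1 := hS (c.getVert 1) (by simp)
  have s3 := hS (c.getVert 3) (by simp)
  simp only [Set.mem_insert_iff, Set.mem_singleton_iff] at s0 s1 s3
  have base : f (c.getVert 0) = c.getVert 0 ∧ f (c.getVert 1) = c.getVert 1 := by
    simp only [zero_add, Nat.reduceAdd] at e01 e12 e32
    rcases s0 with s0 | s0 | s0 <;> rcases s1 with s1 | s1 | s1 <;>
      rcases s3 with s3 | s3 | s3 <;> simp_all only [ne_eq, not_true_eq_false, and_self]
  suffices h : ∀ i, i + 1 < c.length →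
      f (c.getVert i) = c.getVert i ∧ f (c.getVert (i + 1)) = c.getVert (i + 1) by
    intro i hi
    rcases i with _ | i
    · exact base.1
    · exact (h i hi).2
  intro i
  induction i with
  | zero => exact fun _ => base
  | succ i ih =>
    intro hi
    obtain ⟨h0, h1⟩ := ih (by omega)
    refine ⟨h1, ?_⟩
    have e := hE _ _ (c.mk_getVert_getVert_succ_mem_edges (i := i + 1) (by omega))
    rw [h1] at e
    rcases hc.eq_or_eq_of_mem_edges (by omega) (by omega) e with h | h
    · rw [Nat.add_sub_cancel, ← h0] at h
      have := inj (by omega) (by omega) (hf h)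
      omega
    · exact h

end SimpleGraph.Walk

/-- If `G` is a connected graph of order `n ≥ 6` with exactly one Hamiltonian cycle,
then `D(G) ≤ 2`. -/
theorem distinguishingNumber_le_two_of_unique_hamiltonianCycle {V : Type*} [Fintype V]
    [DecidableEq V] (G : SimpleGraph V)
    (hconn : G.Connected)
    (hn : 6 ≤ Fintype.card V)
    (hex : ∃ (v : V) (c : G.Walk v v), c.IsHamiltonianCycle)
    (huniq : ∀ (v w : V) (c : G.Walk v v) (d : G.Walk w w),
      c.IsHamiltonianCycle → d.IsHamiltonianCycle → c.edges.toFinset = d.edges.toFinset) :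
    distinguishingNumber G ≤ 2 := by
  classical
  obtain ⟨u, c, hc⟩ := hex
  have hlen : c.length = Fintype.card V := hc.length_eq
  let S : Set V := {c.getVert 0, c.getVert 1, c.getVert 3}
  refine Nat.sInf_le ⟨fun v => if v ∈ S then 1 else 0, fun f hf v => ?_⟩
  have hE : ∀ a b, s(a, b) ∈ c.edges → s(f a, f b) ∈ c.edges := fun a b h => by
    have hmap : (c.map f.toHom).IsHamiltonianCycle := hc.map f.bijective
    rw [← List.mem_toFinset, huniq _ _ c _ hc hmap, List.mem_toFinset, Walk.edges_map]
    exact List.mem_map_of_mem (f := Sym2.map f.toHom) h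
  have hS : ∀ v ∈ S, f v ∈ S := fun v hv => by
    by_contra h
    simpa [hv, h] using hf v
  obtain ⟨i, rfl, hi⟩ := (Walk.mem_support_iff_exists_getVert).1 (hc.mem_support v)
  have hfix := hc.isCycle.map_getVert_eq_of_preserves (by omega) f.injective hE hS
  rcases hi.lt_or_eq with hi | rfl
  · exact hfix i hi
  · simpa using hfix 0 (by omega)
end

section
/- Let T be a finite tree of order at least 4 with no vertex of degree two, and let G be a graph obtained from T by adding edges so that the set of leaves of T induces, together with the added edges, a cycle C on the leaf set. If f is an automorphism of G that fixes every vertex of C, then f is the identity automorphism of G. -/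
open SimpleGraph

/-- The edge set of `H` is exactly a cycle passing through the set `S`. -/
def IsCycleOn {V : Type*} (H : SimpleGraph V) (S : Set V) : Prop :=
  ∃ (v : V) (c : H.Walk v v), c.IsCycle ∧ {x | x ∈ c.support} = S ∧
    ∀ e, e ∈ H.edgeSet ↔ e ∈ c.edges

namespace SimpleGraph

/-- In a tree, a vertex has at most one neighbour that is closer to the root `r`. -/
lemma IsTree.eq_of_adj_of_dist_eq_add_one {V : Type*} {T : SimpleGraph V} (hT : T.IsTree)
    {r w a b : V} (ha : T.Adj a w) (hb : T.Adj b w) (hda : T.dist r w = T.dist r a + 1)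
    (hdb : T.dist r w = T.dist r b + 1) : a = b := by
  obtain ⟨p, -, hp⟩ := hT.connected.exists_path_of_dist r a
  obtain ⟨q, -, hq⟩ := hT.connected.exists_path_of_dist r b
  have hpa : (p.concat ha).IsPath := Walk.isPath_of_length_eq_dist _ (by simp [hp, hda])
  have hqb : (q.concat hb).IsPath := Walk.isPath_of_length_eq_dist _ (by simp [hq, hdb])
  have h := congrArg Walk.penultimate ((hT.existsUnique_path r w).unique hpa hqb)
  simpa using h

/-- In a tree, a vertex that is not a leaf has a neighbour farther away from the root `r`. -/
lemma IsTree.exists_adj_dist_eq_add_one {V : Type*} [Fintype V] [Nontrivial V]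
    {T : SimpleGraph V} [DecidableRel T.Adj] (hT : T.IsTree) (r : V) {v : V}
    (hv : T.degree v ≠ 1) : ∃ w, T.Adj v w ∧ T.dist r w = T.dist r v + 1 := by
  have hpos := hT.connected.preconnected.degree_pos_of_nontrivial v
  obtain ⟨a, ha, b, hb, hab⟩ := Finset.one_lt_card.mp
    (show 1 < (T.neighborFinset v).card by rw [card_neighborFinset_eq_degree]; omega)
  rw [mem_neighborFinset] at ha hb
  by_contra! h
  have closer {x : V} (hx : T.Adj v x) : T.dist r v = T.dist r x + 1 :=
    (hT.dist_eq_dist_add_one_of_adj r hx).resolve_right (h x hx)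
  exact hab (hT.eq_of_adj_of_dist_eq_add_one ha.symm hb.symm (closer ha) (closer hb))

/-- An endomorphism of a finite tree that fixes every leaf is the identity. -/
lemma IsTree.hom_apply_eq_self_of_forall_degree_eq_one {V : Type*} [Fintype V] [Nontrivial V]
    {T : SimpleGraph V} [DecidableRel T.Adj] (hT : T.IsTree) (φ : T →g T)
    (hφ : ∀ v, T.degree v = 1 → φ v = v) (v : V) : φ v = v := by
  classical
  obtain ⟨r, hr⟩ := hT.exists_vert_degree_one_of_nontrivial
  by_contra hv
  obtain ⟨u, hu, hmax⟩ := Finset.exists_max_image {x | φ x ≠ x} (T.dist r) ⟨v, by simpa using hv⟩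
  simp only [Finset.mem_filter, Finset.mem_univ, true_and] at hu hmax
  obtain ⟨w, huw, hd⟩ := hT.exists_adj_dist_eq_add_one r (mt (hφ u) hu)
  have hw : φ w = w := by
    by_contra hw
    have := hmax w hw
    omega
  have hφuw : T.Adj (φ u) w := hw ▸ φ.map_adj huw
  obtain ⟨p, hp⟩ := hT.connected.exists_walk_length_eq_dist r u
  have hle : T.dist r (φ u) ≤ T.dist r u := by
    simpa [hφ r hr, hp] using dist_le (p.map φ)
  have hd' : T.dist r w = T.dist r (φ u) + 1 := by
    rcases hT.dist_eq_dist_add_one_of_adj r hφuw with h | h <;> omega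
  exact hu (hT.eq_of_adj_of_dist_eq_add_one hφuw huw hd' hd)

end SimpleGraph

lemma IsCycleOn.mem_of_adj {V : Type*} {H : SimpleGraph V} {S : Set V} (hH : IsCycleOn H S)
    {x y : V} (h : H.Adj x y) : x ∈ S := by
  obtain ⟨v, c, -, rfl, hc⟩ := hH
  exact c.fst_mem_support_of_mem_edges ((hc s(x, y)).mp h)

/-- If `T` is a tree of order at least four with no vertex of degree two and `G` is
obtained from `T` by adding a cycle through the leaves of `T`, then any automorphism
of `G` fixing every vertex of the cycle (i.e. every leaf of `T`) is the identity. -/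
theorem halin_fix_cycle_eq_id {V : Type*} [Fintype V] [DecidableEq V]
    (T C G : SimpleGraph V) [DecidableRel T.Adj]
    (hT : T.IsTree) (horder : 4 ≤ Fintype.card V)
    (hdeg2 : ∀ v : V, T.degree v ≠ 2)
    (hC : IsCycleOn C {v : V | T.degree v = 1})
    (hdisj : Disjoint T C)
    (hG : G = T ⊔ C)
    (f : G ≃g G) (hf : ∀ v : V, T.degree v = 1 → f v = v) :
    ∀ v : V, f v = v := by
  subst hG
  have : Nontrivial V := Fintype.one_lt_card_iff_nontrivial.mp (by omega)
  have hfix {x : V} (hx : T.degree (f x) = 1) : f x = x := f.injective (hf _ hx)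
  have hmap {u v : V} (huv : T.Adj u v) : T.Adj (f u) (f v) := by
    have hfuv : (T ⊔ C).Adj (f u) (f v) := f.map_adj_iff.mpr (Or.inl huv)
    refine hfuv.resolve_right fun hC' ↦ ?_
    rw [hfix (hC.mem_of_adj hC'), hfix (hC.mem_of_adj hC'.symm)] at hC'
    exact disjoint_left.mp hdisj u v huv hC'
  exact hT.hom_apply_eq_self_of_forall_degree_eq_one ⟨f, hmap⟩ hf
end

section
/- Let T be a finite tree of order at least 4 with no vertex of degree two, and let G be a graph obtained from T by adding edges so that the leaves of T form a cycle. Then the distinguishing number of G satisfies D(G) ≤ 4. -/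
open SimpleGraph

namespace SimpleGraph

variable {V : Type*}

/-- In a tree, the neighbor of `w` that is closer to `r` is unique. -/
lemma IsTree.eq_of_adj_of_dist_add_one_eq {T : SimpleGraph V} (hT : T.IsTree) {r u v w : V}
    (hu : T.Adj u w) (hv : T.Adj v w) (hdu : T.dist r u + 1 = T.dist r w)
    (hdv : T.dist r v + 1 = T.dist r w) : u = v := by
  obtain ⟨p, hp⟩ := hT.connected.exists_walk_length_eq_dist r u
  obtain ⟨q, hq⟩ := hT.connected.exists_walk_length_eq_dist r v
  have hp' : (p.concat hu).IsPath :=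
    Walk.isPath_of_length_eq_dist _ (by rw [Walk.length_concat]; lia)
  have hq' : (q.concat hv).IsPath :=
    Walk.isPath_of_length_eq_dist _ (by rw [Walk.length_concat]; lia)
  have h := (hT.existsUnique_path r w).unique hp' hq'
  simpa using congrArg Walk.penultimate h

/-- An automorphism of a finite tree that fixes every leaf is the identity. -/
lemma IsTree.iso_apply_eq_of_fixes_leaves [Fintype V] {T : SimpleGraph V} [DecidableRel T.Adj]
    (hT : T.IsTree) (f : T ≃g T) (hf : ∀ v, T.degree v = 1 → f v = v) (v : V) : f v = v := by
  classical
  rcases subsingleton_or_nontrivial V with _ | _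
  · exact Subsingleton.elim _ _
  obtain ⟨r, hr⟩ := hT.exists_vert_degree_one_of_nontrivial
  by_contra hv
  obtain ⟨v, hv, hmax⟩ := Finset.exists_max_image {v : V | f v ≠ v} (T.dist r) ⟨v, by simpa⟩
  simp only [Finset.mem_filter, Finset.mem_univ, true_and] at hv hmax
  have hpos := hT.connected.preconnected.degree_pos_of_nontrivial v
  have hcard : 1 < (T.neighborFinset v).card := by
    have : T.degree v ≠ 1 := fun h ↦ hv (hf v h)
    rw [card_neighborFinset_eq_degree]
    lia
  obtain ⟨a, ha, b, hb, hab⟩ := Finset.one_lt_card.mp hcard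
  rw [mem_neighborFinset] at ha hb
  obtain ⟨w, hw, hd⟩ : ∃ w, T.Adj v w ∧ T.dist r w = T.dist r v + 1 := by
    rcases hT.dist_eq_dist_add_one_of_adj r ha with h | h
    · rcases hT.dist_eq_dist_add_one_of_adj r hb with h' | h'
      · exact absurd (hT.eq_of_adj_of_dist_add_one_eq ha.symm hb.symm h.symm h'.symm) hab
      · exact ⟨b, hb, h'⟩
    · exact ⟨a, ha, h⟩
  have hfw : f w = w := by
    by_contra h
    have := hmax w h
    lia
  have hadj : T.Adj (f v) w := by simpa [hfw] using f.map_adj_iff.mpr hw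
  have hle : T.dist r (f v) ≤ T.dist r v := by
    obtain ⟨p, hp⟩ := hT.connected.exists_walk_length_eq_dist r v
    have h := dist_le (p.map f.toHom)
    rw [Walk.length_map, hp] at h
    simpa [hf r hr] using h
  refine hv (hT.eq_of_adj_of_dist_add_one_eq (r := r) hadj hw ?_ hd.symm)
  rcases hT.dist_eq_dist_add_one_of_adj r hadj with h | h <;> lia

/-- Two adjacent leaves span a whole connected graph. -/
lemma Connected.card_le_two_of_adj_of_degree_eq_one [Fintype V] {T : SimpleGraph V}
    [DecidableRel T.Adj] (hT : T.Connected) {x y : V} (hx : T.degree x = 1) (hy : T.degree y = 1)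
    (hxy : T.Adj x y) : Fintype.card V ≤ 2 := by
  classical
  have key {a b c : V} (ha : T.degree a = 1) (hab : T.Adj a b) (hac : T.Adj a c) : c = b :=
    (degree_eq_one_iff_existsUnique_adj.mp ha).unique hac hab
  have hall (z : V) : z = x ∨ z = y := by
    induction (reachable_iff_reflTransGen x z).mp (hT.preconnected x z) with
    | refl => exact Or.inl rfl
    | tail _ h ih =>
      rcases ih with rfl | rfl
      · exact Or.inr (key hx hxy h)
      · exact Or.inl (key hy hxy.symm h)
  calc Fintype.card V = (Finset.univ : Finset V).card := rfl
    _ ≤ ({x, y} : Finset V).card := Finset.card_le_card fun z _ ↦ by simpa using hall z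
    _ ≤ 2 := Finset.card_le_two

/-- An injective map preserving the edges of a cycle and fixing its first two vertices fixes the
whole cycle. -/
lemma Walk.IsCycle.apply_eq_of_mem_support {C : SimpleGraph V} {u : V} {c : C.Walk u u}
    (hc : c.IsCycle) {f : V → V} (hf : f.Injective)
    (hadj : ∀ x y, s(x, y) ∈ c.edges → s(f x, f y) ∈ c.edges)
    (h0 : f u = u) (h1 : f c.snd = c.snd) {x : V} (hx : x ∈ c.support) : f x = x := by
  have key (i : ℕ) (hi : i + 1 ≤ c.length) :
      f (c.getVert i) = c.getVert i ∧ f (c.getVert (i + 1)) = c.getVert (i + 1) := by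
    induction i with
    | zero => exact ⟨by simpa using h0, h1⟩
    | succ i ih =>
      obtain ⟨ih0, ih1⟩ := ih (by lia)
      refine ⟨ih1, ?_⟩
      have h := hadj _ _ (adj_toSubgraph_iff_mem_edges.mp (c.toSubgraph_adj_getVert hi))
      rw [ih1, ← adj_toSubgraph_iff_mem_edges, ← Subgraph.mem_neighborSet,
        hc.neighborSet_toSubgraph_internal (by lia) (by lia)] at h
      rcases h with h | h
      · rw [Nat.add_sub_cancel] at h
        exact absurd (hf (h.trans ih0.symm))
          (hc.getVert_sub_one_ne_getVert_add_one (i := i + 1) (by lia)).symm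
      · exact h
  obtain ⟨i, rfl, hi⟩ := mem_support_iff_exists_getVert.mp hx
  rcases i with _ | i
  · simpa using h0
  · exact (key i hi).2

end SimpleGraph

/-- If `T` is a tree of order at least four with no vertex of degree two and `G` is
obtained from `T` by adding a cycle through the leaves of `T`, then `D(G) ≤ 4`. -/
theorem halin_distinguishingNumber_le_four {V : Type*} [Fintype V] [DecidableEq V]
    (T C G : SimpleGraph V) [DecidableRel T.Adj]
    (hT : T.IsTree) (horder : 4 ≤ Fintype.card V)
    (hdeg2 : ∀ v : V, T.degree v ≠ 2)
    (hC : IsCycleOn C {v : V | T.degree v = 1})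
    (hdisj : Disjoint T C)
    (hG : G = T ⊔ C) :
    distinguishingNumber G ≤ 4 := by
  obtain ⟨u, c, hc, hsupp, hedge⟩ := hC
  have hleaf (x : V) : x ∈ c.support ↔ T.degree x = 1 := Set.ext_iff.mp hsupp x
  have hCG (x y : V) : C.Adj x y ↔ G.Adj x y ∧ T.degree x = 1 ∧ T.degree y = 1 := by
    refine ⟨fun h ↦ ?_, fun ⟨h, hx, hy⟩ ↦ ?_⟩
    · have he := (hedge s(x, y)).mp h
      exact ⟨hG ▸ Or.inr h, (hleaf x).mp (c.fst_mem_support_of_mem_edges he),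
        (hleaf y).mp (c.snd_mem_support_of_mem_edges he)⟩
    · rw [hG] at h
      refine h.resolve_left fun h ↦ ?_
      have := hT.connected.card_le_two_of_adj_of_degree_eq_one hx hy h
      lia
  have hTG (x y : V) : T.Adj x y ↔ G.Adj x y ∧ ¬ C.Adj x y := by
    have hne : ¬ (T.Adj x y ∧ C.Adj x y) := fun h ↦ (disjoint_iff_inf_le.mp hdisj) h
    rw [hG, sup_adj]
    tauto
  refine Nat.sInf_le ⟨fun x ↦ if T.degree x = 1 then if x = u then 0 else
    if x = c.snd then 1 else 2 else 3, fun f hf ↦ ?_⟩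
  beta_reduce at hf
  have hu : T.degree u = 1 := (hleaf u).mp c.start_mem_support
  have hsnd : T.degree c.snd = 1 := (hleaf _).mp (c.getVert_mem_support 1)
  have hdeg (x : V) : T.degree (f x) = 1 ↔ T.degree x = 1 := by
    have := hf x
    grind
  have hfu : f u = u := by
    have := hf u
    grind
  have hfsnd : f c.snd = c.snd := by
    have hne : c.snd ≠ u := (c.adj_snd hc.not_nil).ne'
    have := hf c.snd
    grind
  have hfC (x y : V) : C.Adj (f x) (f y) ↔ C.Adj x y := by
    rw [hCG, hCG, hdeg, hdeg, f.map_adj_iff]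
  have hfT {x y : V} : T.Adj (f x) (f y) ↔ T.Adj x y := by
    rw [hTG, hTG, hfC, f.map_adj_iff]
  refine hT.iso_apply_eq_of_fixes_leaves ⟨f.toEquiv, hfT⟩ fun x hx ↦ ?_
  exact hc.apply_eq_of_mem_support f.injective
    (fun a b h ↦ (hedge _).mp ((hfC a b).mpr ((hedge _).mpr h))) hfu hfsnd ((hleaf x).mpr hx)
end

section
/- Let T be a finite tree of order at least 4 with no vertex of degree two and no vertex of degree three, and let G be a graph obtained from T by adding edges so that the leaves of T form a cycle. Then the distinguishing number of G satisfies D(G) ≤ 3. -/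
open SimpleGraph

namespace SimpleGraph

variable {V : Type*} {T C : SimpleGraph V}

/-- In a tree, a vertex has at most one neighbor closer to a given root. -/
lemma IsTree.eq_of_adj_of_dist_add_one (hT : T.IsTree) {r a b w : V}
    (ha : T.Adj a w) (hb : T.Adj b w)
    (hda : T.dist r w = T.dist r a + 1) (hdb : T.dist r w = T.dist r b + 1) : a = b := by
  obtain ⟨p, hp⟩ := hT.connected.exists_walk_length_eq_dist r a
  obtain ⟨q, hq⟩ := hT.connected.exists_walk_length_eq_dist r b
  have hp' : (p.concat ha).IsPath :=
    Walk.isPath_of_length_eq_dist _ (by rw [Walk.length_concat, hp, hda])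
  have hq' : (q.concat hb).IsPath :=
    Walk.isPath_of_length_eq_dist _ (by rw [Walk.length_concat, hq, hdb])
  have h : p.concat ha = q.concat hb :=
    congrArg Subtype.val
      ((hT.isAcyclic.subsingleton_path r w).elim ⟨_, hp'⟩ ⟨_, hq'⟩)
  simpa using congrArg Walk.penultimate h

/-- An injective endomorphism of a finite tree that fixes some vertex and every vertex with fewer
than two neighbors is the identity. -/
lemma IsTree.eq_self_of_fixes_leaves [Finite V] (hT : T.IsTree) {f : V → V}
    (hf : Function.Injective f) (hadj : ∀ u v, T.Adj u v → T.Adj (f u) (f v)) (r : V)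
    (hfix : ∀ v, f v ≠ v → ∃ a b, a ≠ b ∧ T.Adj v a ∧ T.Adj v b) (v : V) : f v = v := by
  by_contra hv
  obtain ⟨v, hv, hmax⟩ :=
    Set.exists_max_image {v | f v ≠ v} (T.dist r) (Set.toFinite _) ⟨v, hv⟩
  obtain ⟨w, hvw, hw⟩ : ∃ w, T.Adj v w ∧ T.dist r w = T.dist r v + 1 := by
    obtain ⟨a, b, hab, ha, hb⟩ := hfix v hv
    rcases hT.dist_eq_dist_add_one_of_adj r ha with h1 | h1
    · rcases hT.dist_eq_dist_add_one_of_adj r hb with h2 | h2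
      · exact (hab (hT.eq_of_adj_of_dist_add_one ha.symm hb.symm h1 h2)).elim
      · exact ⟨b, hb, h2⟩
    · exact ⟨a, ha, h1⟩
  have hfw : f w = w := by
    by_contra h
    have := hmax w h
    omega
  have hfv : T.Adj (f v) w := hfw ▸ hadj v w hvw
  rcases hT.dist_eq_dist_add_one_of_adj r hfv with h | h
  · refine hv (hf ?_)
    by_contra h'
    have := hmax (f v) h'
    omega
  · exact hv (hT.eq_of_adj_of_dist_add_one hfv hvw h hw)

/-- If every non-isolated vertex has two neighbors, an injective endomorphism that fixes two
adjacent vertices fixes the connected component of these vertices. -/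
lemma Walk.eq_self_of_fixes_adj {f : V → V} (hf : Function.Injective f)
    (hadj : ∀ u v, C.Adj u v → C.Adj (f u) (f v))
    (hdeg : ∀ u v, C.Adj u v → (C.neighborSet u).ncard = 2)
    {y w : V} (p : C.Walk y w) {x : V} (hxy : C.Adj x y) (hx : f x = x) (hy : f y = y) :
    f w = w := by
  induction p generalizing x with
  | nil => exact hy
  | @cons y z w hyz p ih =>
    refine ih hyz hy ?_
    by_contra hz
    obtain ⟨a, b, -, hab⟩ := Set.ncard_eq_two.1 (hdeg y z hyz)
    have mem (t : V) (ht : C.Adj y t) : t = a ∨ t = b := by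
      have : t ∈ C.neighborSet y := ht
      rwa [hab] at this
    have hfz : C.Adj y (f z) := by simpa only [hy] using hadj y z hyz
    have hxz : x ≠ z := fun h ↦ hz (h ▸ hx)
    have hfzx : f z ≠ x := fun h ↦ hxz (hf (hx.trans h.symm))
    grind [mem x hxy.symm, mem z hyz, mem (f z) hfz]

/-- Two adjacent vertices of a connected graph without other neighbors are the only vertices. -/
lemma Connected.card_le_two_of_adj [Fintype V] (hT : T.Connected) {u v : V}
    (hu : ∀ w, T.Adj u w → w = v) (hv : ∀ w, T.Adj v w → w = u) : Fintype.card V ≤ 2 := by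
  classical
  have key {a b : V} (p : T.Walk a b) : a = u ∨ a = v → b = u ∨ b = v := by
    induction p with
    | nil => exact id
    | cons h p ih => grind
  have : (Finset.univ : Finset V) ⊆ {u, v} := fun w _ ↦ by
    simpa using key (hT.preconnected u w).some (Or.inl rfl)
  exact (Finset.card_le_card this).trans Finset.card_le_two

end SimpleGraph

/-- Every vertex of a cycle has two neighbors on it. -/
lemma IsCycleOn.ncard_neighborSet {V : Type*} {C : SimpleGraph V} {S : Set V}
    (hC : IsCycleOn C S) {u : V} (hu : u ∈ S) : (C.neighborSet u).ncard = 2 := by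
  obtain ⟨x, c, hc, rfl, he⟩ := hC
  rw [← hc.ncard_neighborSet_toSubgraph_eq_two hu]
  congr 1
  ext w
  rw [SimpleGraph.mem_neighborSet, SimpleGraph.Subgraph.mem_neighborSet,
    SimpleGraph.Walk.adj_toSubgraph_iff_mem_edges, ← he, SimpleGraph.mem_edgeSet]

/-- The edges of a cycle join vertices of the cycle. -/
lemma IsCycleOn.mem_of_adj_s4 {V : Type*} {C : SimpleGraph V} {S : Set V}
    (hC : IsCycleOn C S) {u v : V} (h : C.Adj u v) : u ∈ S := by
  obtain ⟨x, c, hc, rfl, he⟩ := hC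
  exact c.fst_mem_support_of_mem_edges ((he s(u, v)).1 h)

/-- Any two vertices of a cycle are joined by a walk in it. -/
lemma IsCycleOn.reachable {V : Type*} {C : SimpleGraph V} {S : Set V}
    (hC : IsCycleOn C S) {u v : V} (hu : u ∈ S) (hv : v ∈ S) : C.Reachable u v := by
  classical
  obtain ⟨x, c, hc, rfl, he⟩ := hC
  exact (c.takeUntil u hu).reachable.symm.trans (c.takeUntil v hv).reachable

/-- If `T` is a tree of order at least four with no vertex of degree two or three and
`G` is obtained from `T` by adding a cycle through the leaves of `T`, then `D(G) ≤ 3`. -/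
theorem halin_distinguishingNumber_le_three {V : Type*} [Fintype V] [DecidableEq V]
    (T C G : SimpleGraph V) [DecidableRel T.Adj]
    (hT : T.IsTree) (horder : 4 ≤ Fintype.card V)
    (hdeg2 : ∀ v : V, T.degree v ≠ 2)
    (hC : IsCycleOn C {v : V | T.degree v = 1})
    (hdisj : Disjoint T C)
    (hG : G = T ⊔ C)
    (hdeg3 : ∀ v : V, T.degree v ≠ 3) :
    distinguishingNumber G ≤ 3 := by
  classical
  set S : Set V := {v : V | T.degree v = 1}
  have ncard_T (v : V) : (T.neighborSet v).ncard = T.degree v := by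
    rw [Set.ncard_eq_toFinset_card', ← SimpleGraph.card_neighborFinset_eq_degree]
    rfl
  have neighborSet_G (v : V) : G.neighborSet v = T.neighborSet v ∪ C.neighborSet v := by
    subst hG
    ext w
    simp
  have ncard_leaf {v : V} (hv : v ∈ S) : (G.neighborSet v).ncard = 3 := by
    rw [neighborSet_G, Set.ncard_union_eq, ncard_T, hC.ncard_neighborSet hv,
      show T.degree v = 1 from hv]
    exact Set.disjoint_left.2 fun w h1 h2 ↦ SimpleGraph.disjoint_left.1 hdisj v w h1 h2
  have ncard_inner {v : V} (hv : v ∉ S) : (G.neighborSet v).ncard ≠ 3 := by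
    have : C.neighborSet v = ∅ := Set.eq_empty_of_forall_notMem fun w hw ↦ hv (hC.mem_of_adj_s4 hw)
    rw [neighborSet_G, this, Set.union_empty, ncard_T]
    exact hdeg3 v
  have leaf_unique {u a b : V} (hu : u ∈ S) (ha : T.Adj u a) (hb : T.Adj u b) : a = b := by
    have h : (T.neighborSet u).ncard = 1 := (ncard_T u).trans hu
    obtain ⟨x, hx⟩ := Set.ncard_eq_one.1 h
    have h1 : a ∈ T.neighborSet u := ha
    have h2 : b ∈ T.neighborSet u := hb
    rw [hx] at h1 h2
    exact h1.trans h2.symm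
  have not_adj {u v : V} (hu : u ∈ S) (hv : v ∈ S) : ¬ T.Adj u v := fun h ↦ by
    have := hT.connected.card_le_two_of_adj (u := u) (v := v)
      (fun w hw ↦ leaf_unique hu hw h) (fun w hw ↦ leaf_unique hv hw h.symm)
    omega
  have adj_C (u v : V) : C.Adj u v ↔ G.Adj u v ∧ u ∈ S ∧ v ∈ S := by
    subst hG
    refine ⟨fun h ↦ ⟨Or.inr h, hC.mem_of_adj_s4 h, hC.mem_of_adj_s4 h.symm⟩, ?_⟩
    rintro ⟨h | h, hu, hv⟩
    · exact (not_adj hu hv h).elim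
    · exact h
  have adj_T (u v : V) : T.Adj u v ↔ G.Adj u v ∧ ¬ (u ∈ S ∧ v ∈ S) := by
    subst hG
    refine ⟨fun h ↦ ⟨Or.inl h, fun h' ↦ not_adj h'.1 h'.2 h⟩, ?_⟩
    rintro ⟨h | h, h'⟩
    · exact h
    · exact (h' ⟨hC.mem_of_adj_s4 h, hC.mem_of_adj_s4 h.symm⟩).elim
  have two_neighbors {v : V} (hv : v ∉ S) : ∃ a b, a ≠ b ∧ T.Adj v a ∧ T.Adj v b := by
    have : Nontrivial V := Fintype.one_lt_card_iff_nontrivial.1 (by omega)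
    have hpos := hT.connected.preconnected.degree_pos_of_nontrivial v
    have hv' : T.degree v ≠ 1 := hv
    have h : 1 < (T.neighborSet v).ncard := by
      rw [ncard_T]
      omega
    obtain ⟨a, b, ha, hb, hab⟩ := (Set.one_lt_ncard_iff (Set.toFinite _)).1 h
    exact ⟨a, b, hab, ha, hb⟩
  obtain ⟨x, y, hxy⟩ : ∃ x y, C.Adj x y := by
    obtain ⟨x, hx⟩ : S.Nonempty := by
      obtain ⟨x, c, -, hc, -⟩ := hC
      exact ⟨x, hc ▸ c.start_mem_support⟩
    have h := hC.ncard_neighborSet hx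
    obtain ⟨y, hy⟩ := Set.nonempty_of_ncard_ne_zero (h.trans_ne two_ne_zero)
    exact ⟨x, y, hy⟩
  refine Nat.sInf_le ⟨fun v ↦ if v = x then 0 else if v = y then 1 else 2, fun f hf ↦ ?_⟩
  have hx : f x = x := by
    have := hf x
    grind
  have hy : f y = y := by
    have := hf y
    have := hxy.ne
    grind
  have ncard_f (v : V) : (G.neighborSet (f v)).ncard = (G.neighborSet v).ncard := by
    rw [← Nat.card_coe_set_eq, ← Nat.card_coe_set_eq]
    exact (Nat.card_congr (f.mapNeighborSet v)).symm
  have mem_f (v : V) : f v ∈ S ↔ v ∈ S := by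
    by_cases h : v ∈ S <;> by_cases h' : f v ∈ S
    · tauto
    · exact (ncard_inner h' ((ncard_f v).trans (ncard_leaf h))).elim
    · exact (ncard_inner h ((ncard_f v).symm.trans (ncard_leaf h'))).elim
    · tauto
  refine hT.eq_self_of_fixes_leaves f.injective (fun u v h ↦ ?_) x fun v hv ↦ two_neighbors ?_
  · rw [adj_T, f.map_adj_iff, mem_f, mem_f]
    exact (adj_T u v).1 h
  · refine fun hvS ↦ hv ?_
    obtain ⟨p⟩ := hC.reachable (hC.mem_of_adj_s4 hxy.symm) hvS
    refine p.eq_self_of_fixes_adj f.injective (fun u w h ↦ ?_)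
      (fun u w h ↦ hC.ncard_neighborSet (hC.mem_of_adj_s4 h)) hxy hx hy
    rw [adj_C, f.map_adj_iff, mem_f, mem_f]
    exact (adj_C u w).1 h
end
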